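/- Let Γ be a finitely generated group with polynomial growth rate D ≥ 1 and finite symmetric generating set S, let N ⊴ Γ be a normal subgroup of finite index with fixed coset representatives z_{(1)}, …, z_{(κ)} and π_N(x) = z_{(j)}⁻¹x for x ∈ z_{(j)}N, and let T ⊴ N be a finite normal subgroup of N (the torsion subgroup of N). Write ⟦x⟧ := π_N(x)·T ⊆ N. Let θ be a measure-preserving action of Γ on a probability space (Ω,F,P) and c : Γ × Ω → [0,∞) a subadditive cocycle satisfying condition (I). Then for all ε, r > 0, P-almost surely there exists M > 0 such that for every integer n > M, every x ∈ Γ with ‖x‖_S < rn, every x₁, x₂ ∈ ⟦x⟧ and every y₁, y₂ ∈ T, one has |c(x₁, θ_{y₁}(ω)) − c(x₂, θ_{y₂}(ω))| < εn. -/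

import Mathlib

open MeasureTheory Filter Topology

section Defs

variable {Γ : Type*} [Group Γ]

/-- The word length of `x` with respect to a generating set `S`. -/
noncomputable def wordLength (S : Set Γ) (x : Γ) : ℕ :=
  sInf {n | ∃ l : List Γ, (∀ s ∈ l, s ∈ S) ∧ l.prod = x ∧ l.length = n}

/-- The abelianized word norm `‖x‖_S^{ab} = inf {‖y‖_S : y ∈ x[Γ,Γ]}`. -/
noncomputable def wordLengthAb (S : Set Γ) (x : Γ) : ℕ :=
  sInf {n | ∃ w ∈ commutator Γ, wordLength S (x * w) = n}

/-- `Γ` has polynomial growth rate `D` with respect to `S`. -/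
def HasPolyGrowth (S : Set Γ) (D : ℕ) : Prop :=
  ∃ k : ℝ, 1 < k ∧ ∀ r : ℝ, 1 < r →
    k⁻¹ * r ^ D ≤ (Nat.card {x : Γ | (wordLength S x : ℝ) < r} : ℝ) ∧
    (Nat.card {x : Γ | (wordLength S x : ℝ) < r} : ℝ) ≤ k * r ^ D

/-- A measure-preserving (left) action of `Γ` on a probability space. -/
def IsPMPAction {Ω : Type*} [MeasurableSpace Ω] (θ : Γ → Ω → Ω) (P : Measure Ω) : Prop :=
  θ 1 = id ∧ (∀ x y : Γ, θ (x * y) = θ x ∘ θ y) ∧ ∀ x : Γ, MeasurePreserving (θ x) P P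

/-- Ergodicity of the action `θ`. -/
def IsErgodicAction {Ω : Type*} [MeasurableSpace Ω] (θ : Γ → Ω → Ω) (P : Measure Ω) : Prop :=
  ∀ E : Set Ω, MeasurableSet E → (∀ x : Γ, θ x ⁻¹' E = E) → P E = 0 ∨ P E = 1

/-- A (nonnegative) subadditive cocycle for the action `θ`. -/
def SubadditiveCocycle {Ω : Type*} [MeasurableSpace Ω] (θ : Γ → Ω → Ω) (P : Measure Ω)
    (c : Γ → Ω → ℝ) : Prop :=
  (∀ x : Γ, Measurable (c x)) ∧ (∀ x ω, 0 ≤ c x ω) ∧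
  ∀ x y : Γ, ∀ᵐ ω ∂P, c (x * y) ω ≤ c y ω + c x (θ y ω)

end Defs

lemma wl_exists {Γ : Type*} [Group Γ] (S : Set Γ) (hSsym : ∀ s ∈ S, s⁻¹ ∈ S)
    (hSgen : Subgroup.closure S = ⊤) (x : Γ) :
    ∃ l : List Γ, (∀ s ∈ l, s ∈ S) ∧ l.prod = x ∧ l.length = wordLength S x := by
  have hne : {n | ∃ l : List Γ, (∀ s ∈ l, s ∈ S) ∧ l.prod = x ∧ l.length = n}.Nonempty := by
    have hx : x ∈ Subgroup.closure S := by rw [hSgen]; trivial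
    rw [← Subgroup.mem_toSubmonoid, Subgroup.closure_toSubmonoid] at hx
    obtain ⟨l, hl, hp⟩ := Submonoid.exists_list_of_mem_closure hx
    refine ⟨l.length, l, fun s hs => ?_, hp, rfl⟩
    rcases hl s hs with h | h
    · exact h
    · simpa using hSsym _ h
  exact Nat.sInf_mem hne

lemma wl_mul {Γ : Type*} [Group Γ] (S : Set Γ) (hSsym : ∀ s ∈ S, s⁻¹ ∈ S)
    (hSgen : Subgroup.closure S = ⊤) (x y : Γ) :
    wordLength S (x * y) ≤ wordLength S x + wordLength S y := by
  obtain ⟨l, hl, hp, hn⟩ := wl_exists S hSsym hSgen x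
  obtain ⟨l', hl', hp', hn'⟩ := wl_exists S hSsym hSgen y
  apply Nat.sInf_le
  refine ⟨l ++ l', ?_, by simp [hp, hp'], by simp [hn, hn']⟩
  intro s hs
  rcases List.mem_append.1 hs with h | h
  · exact hl s h
  · exact hl' s h

lemma ball_finite {Γ : Type*} [Group Γ] (S : Set Γ) (D : ℕ) (hD : HasPolyGrowth S D)
    (r : ℝ) (hr : 1 < r) : {x : Γ | (wordLength S x : ℝ) < r}.Finite := by
  obtain ⟨k, hk, h⟩ := hD
  have h1 := (h r hr).1
  have h2 : 0 < k⁻¹ * r ^ D := by positivity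
  have h3 : (0:ℝ) < (Nat.card {x : Γ | (wordLength S x : ℝ) < r} : ℝ) := lt_of_lt_of_le h2 h1
  have h4 : 0 < Nat.card {x : Γ | (wordLength S x : ℝ) < r} := by exact_mod_cast h3
  exact Set.finite_coe_iff.1 (Nat.finite_of_card_ne_zero h4.ne')

lemma countable_grp {Γ : Type*} [Group Γ] (S : Set Γ) (D : ℕ) (hD : HasPolyGrowth S D) :
    Countable Γ := by
  rw [← Set.countable_univ_iff]
  have : (Set.univ : Set Γ) = ⋃ n : ℕ, {x : Γ | (wordLength S x : ℝ) < (n : ℝ) + 2} := by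
    ext x
    simp only [Set.mem_univ, Set.mem_iUnion, Set.mem_ofPred_eq, true_iff]
    exact ⟨wordLength S x, by linarith⟩
  rw [this]
  refine Set.countable_iUnion fun n => (ball_finite S D hD _ ?_).countable
  have : (0:ℝ) ≤ n := Nat.cast_nonneg n
  linarith

lemma small_shift {Γ : Type*} [Group Γ]
    (S : Set Γ) (D : ℕ) (hD : HasPolyGrowth S D)
    (T : Set Γ) (hTfin : T.Finite)
    {Ω : Type*} [MeasurableSpace Ω] (P : Measure Ω)
    (θ : Γ → Ω → Ω) (hθ : IsPMPAction θ P)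
    (c : Γ → Ω → ℝ) (hcm : ∀ x, Measurable (c x))
    (β C κ' : ℝ) (g : ℝ → ℝ) (hκ' : 1 < κ') (hC : 0 < C)
    (hg : ∀ t : ℝ, 1 ≤ t → g t ≤ C * t ^ (-(2 * (D : ℝ) + κ')))
    (hI : ∀ x : Γ, ∀ t : ℝ, β * (wordLength S x : ℝ) < t →
      P {ω | t ≤ c x ω} ≤ ENNReal.ofReal (g t)) (ε R : ℝ) (hε : 0 < ε) (hR : 1 < R) :
    ∀ᵐ ω ∂P, ∀ᶠ n : ℕ in atTop, ∀ u : Γ, (wordLength S u : ℝ) < R * n →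
      ∀ t ∈ T, c t (θ u ω) < ε * n := by
  obtain ⟨k, hk, hcard⟩ := id hD
  set E : ℕ → Set Ω := fun n =>
    ⋃ u ∈ {u : Γ | (wordLength S u : ℝ) < R * n}, ⋃ t ∈ T, {ω | ε * n ≤ c t (θ u ω)} with hE
  set A : ℝ := (k * R ^ D) * (hTfin.toFinset.card * (C * ε ^ (-(2 * (D : ℝ) + κ')))) with hA
  have key : ∀ᶠ n : ℕ in atTop, P (E n) ≤ ENNReal.ofReal (A * (n : ℝ) ^ (-((D : ℝ) + κ'))) := by
    have htend : Tendsto (fun n : ℕ => ε * (n : ℝ)) atTop atTop :=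
      tendsto_natCast_atTop_atTop.const_mul_atTop hε
    have hall : ∀ᶠ n : ℕ in atTop, ∀ t ∈ T, β * (wordLength S t : ℝ) < ε * n := by
      rw [Filter.eventually_all_finite hTfin]
      intro t _
      exact htend.eventually_gt_atTop _
    filter_upwards [hall, htend.eventually_ge_atTop 1, eventually_ge_atTop 1] with n h1 h2 h3
    have hn : (1:ℝ) ≤ n := by exact_mod_cast h3
    have hRn : 1 < R * n := by nlinarith
    have hBf := ball_finite S D hD (R * n) hRn
    have hEn : E n = ⋃ u ∈ hBf.toFinset, ⋃ t ∈ hTfin.toFinset, {ω | ε * n ≤ c t (θ u ω)} := by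
      simp [hE]
    set G : ℝ := C * (ε * n) ^ (-(2 * (D : ℝ) + κ')) with hG
    have hG0 : 0 ≤ G := by positivity
    have hbc : (hBf.toFinset.card : ℝ) ≤ k * (R * n) ^ D := by
      have := (hcard (R * n) hRn).2
      rwa [Nat.card_coe_set_eq, Set.ncard_eq_toFinset_card _ hBf] at this
    have hone : ∀ u, ∀ t ∈ hTfin.toFinset, P {ω | ε * n ≤ c t (θ u ω)} ≤ ENNReal.ofReal G := by
      intro u t ht
      have hpre : {ω | ε * n ≤ c t (θ u ω)} = θ u ⁻¹' {ω | ε * n ≤ c t ω} := rfl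
      rw [hpre, (hθ.2.2 u).measure_preimage
        (measurableSet_le measurable_const (hcm t)).nullMeasurableSet]
      exact (hI t _ (h1 t (by simpa using ht))).trans (ENNReal.ofReal_le_ofReal (hg _ h2))
    calc P (E n) ≤ ∑ u ∈ hBf.toFinset, ∑ t ∈ hTfin.toFinset, ENNReal.ofReal G := by
          rw [hEn]
          refine (measure_biUnion_finset_le _ _).trans (Finset.sum_le_sum fun u _ => ?_)
          exact (measure_biUnion_finset_le _ _).trans (Finset.sum_le_sum fun t ht => hone u t ht)
      _ = ENNReal.ofReal (hBf.toFinset.card * (hTfin.toFinset.card * G)) := by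
          have hgen : ∀ (a b : ℕ) (q : ℝ), ENNReal.ofReal ((a : ℝ) * ((b : ℝ) * q))
              = (a : ENNReal) * ((b : ENNReal) * ENNReal.ofReal q) := by
            intro a b q
            rw [ENNReal.ofReal_mul (by positivity), ENNReal.ofReal_mul (by positivity),
              ENNReal.ofReal_natCast, ENNReal.ofReal_natCast]
          rw [hgen]
          simp only [Finset.sum_const, nsmul_eq_mul]
      _ ≤ ENNReal.ofReal (A * (n : ℝ) ^ (-((D : ℝ) + κ'))) := by
          apply ENNReal.ofReal_le_ofReal
          calc (hBf.toFinset.card * (hTfin.toFinset.card * G) : ℝ)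
              ≤ (k * (R * n) ^ D) * (hTfin.toFinset.card * G) := by gcongr
            _ = A * (n : ℝ) ^ (-((D : ℝ) + κ')) := by
              have e : (n : ℝ) ^ (-((D : ℝ) + κ'))
                  = (n : ℝ) ^ D * (n : ℝ) ^ (-(2 * (D : ℝ) + κ')) := by
                rw [← Real.rpow_natCast, ← Real.rpow_add (by positivity)]
                congr 1; ring
              rw [e, hA, hG, Real.mul_rpow hε.le (by positivity), mul_pow]
              ring
  obtain ⟨n0, hn0⟩ := eventually_atTop.1 key
  have hsum : Summable (fun n : ℕ => A * (n : ℝ) ^ (-((D : ℝ) + κ'))) := by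
    apply Summable.mul_left
    rw [Real.summable_nat_rpow]
    have : (0:ℝ) ≤ D := Nat.cast_nonneg D
    linarith
  have hfin : ∑' n, P (E (n + n0)) ≠ ⊤ := by
    have hs2 := (summable_nat_add_iff n0).2 hsum
    refine ne_top_of_le_ne_top hs2.tsum_ofReal_ne_top
      (ENNReal.tsum_le_tsum fun n => hn0 (n + n0) (by omega))
  filter_upwards [ae_eventually_notMem hfin] with ω hω
  have hω' := (eventually_atTop.1 hω)
  obtain ⟨m, hm⟩ := hω'
  filter_upwards [eventually_ge_atTop (m + n0)] with n hn u hu t ht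
  have := hm (n - n0) (by omega)
  rw [Nat.sub_add_cancel (by omega)] at this
  by_contra hcon
  apply this
  simp only [hE, Set.mem_iUnion]
  exact ⟨u, hu, t, ht, not_lt.1 hcon⟩

/-- almost surely, eventually in `n`, uniformly over `x` in the ball of
radius `rn`, the values `c(x₁, θ_{y₁}(ω))` for `x₁ ∈ ⟦x⟧ = π_N(x)·T` and `y₁ ∈ T` differ
from each other by less than `εn`. -/
theorem cocycle_torsion_comparison {Γ : Type*} [Group Γ]
    (S : Set Γ) (hSfin : S.Finite) (hSsym : ∀ s ∈ S, s⁻¹ ∈ S)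
    (hSgen : Subgroup.closure S = ⊤)
    -- `Γ` has polynomial growth rate `D ≥ 1`
    (D : ℕ) (hD1 : 1 ≤ D) (hD : HasPolyGrowth S D)
    -- `N` is a normal subgroup of finite index `κ`, with coset representatives `z`
    (N : Subgroup Γ) [N.Normal] (κ : ℕ) (hκpos : 0 < κ) (hκ : N.index = κ)
    (z : Fin κ → Γ) (hcover : ∀ x : Γ, ∃ j : Fin κ, (z j)⁻¹ * x ∈ N)
    (π : Γ → Γ) (hπ : ∀ (x : Γ) (j : Fin κ), (z j)⁻¹ * x ∈ N → π x = (z j)⁻¹ * x)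
    -- `T` is the torsion subgroup of `N`: finite and normal in `N`
    (T : Subgroup Γ) (hTN : T ≤ N) (hTfin : (T : Set Γ).Finite)
    (hTnormal : ∀ t ∈ T, ∀ v ∈ N, v * t * v⁻¹ ∈ T)
    (hTtor : ∀ y : Γ, y ∈ T ↔ y ∈ N ∧ IsOfFinOrder y)
    {Ω : Type*} [MeasurableSpace Ω] (P : Measure Ω) [IsProbabilityMeasure P]
    (θ : Γ → Ω → Ω) (hθ : IsPMPAction θ P)
    (c : Γ → Ω → ℝ) (hc : SubadditiveCocycle θ P c)
    -- Condition (I)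
    (β C κ' : ℝ) (g : ℝ → ℝ) (hβ : 0 < β) (hκ' : 1 < κ') (hC : 0 < C)
    (hg : ∀ t : ℝ, 1 ≤ t → g t ≤ C * t ^ (-(2 * (D : ℝ) + κ')))
    (hI : ∀ x : Γ, ∀ t : ℝ, β * (wordLength S x : ℝ) < t →
      P {ω | t ≤ c x ω} ≤ ENNReal.ofReal (g t)) :
    ∀ ε r : ℝ, 0 < ε → 0 < r →
      ∀ᵐ ω ∂P, ∃ M : ℕ, ∀ n : ℕ, M < n → ∀ x : Γ,
        (wordLength S x : ℝ) < r * n →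
        ∀ x₁ ∈ {y : Γ | ∃ t ∈ (T : Set Γ), y = π x * t},
        ∀ x₂ ∈ {y : Γ | ∃ t ∈ (T : Set Γ), y = π x * t},
        ∀ y₁ ∈ (T : Set Γ), ∀ y₂ ∈ (T : Set Γ),
          |c x₁ (θ y₁ ω) - c x₂ (θ y₂ ω)| < ε * n := by
  intro ε r hε hr
  obtain ⟨hcm, hc0, hcs⟩ := hc
  have hcount := countable_grp S D hD
  have hTz : ((Set.univ : Set (Fin κ)) ×ˢ ((T : Set Γ) ×ˢ (T : Set Γ))).Finite :=
    Set.finite_univ.prod (hTfin.prod hTfin)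
  -- a bound on the auxiliary lengths
  obtain ⟨K, hK⟩ : ∃ K : ℕ, ∀ j : Fin κ, ∀ t ∈ T, ∀ y ∈ T,
      wordLength S (z j)⁻¹ + wordLength S t + wordLength S y ≤ K := by
    obtain ⟨K, hK⟩ := (hTz.image (fun p : Fin κ × Γ × Γ =>
      wordLength S (z p.1)⁻¹ + wordLength S p.2.1 + wordLength S p.2.2)).bddAbove
    exact ⟨K, fun j t ht y hy => hK ⟨(j, t, y), ⟨trivial, ht, hy⟩, rfl⟩⟩
  have hsmall := small_shift S D hD (T : Set Γ) hTfin P θ hθ c hcm β C κ' g hκ' hC hg hI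
    (ε / 3) (r + K + 1) (by positivity) (by have : (0:ℝ) ≤ K := Nat.cast_nonneg K
                                            linarith)
  have hsub : ∀ᵐ ω ∂P, ∀ x y w : Γ, c (x * y) (θ w ω) ≤ c y (θ w ω) + c x (θ y (θ w ω)) := by
    rw [ae_all_iff]; intro x
    rw [ae_all_iff]; intro y
    rw [ae_all_iff]; intro w
    exact (hθ.2.2 w).quasiMeasurePreserving.ae (hcs x y)
  filter_upwards [hsmall, hsub] with ω h1 h2
  obtain ⟨M, hM⟩ := eventually_atTop.1 h1
  have hcomp : ∀ x y : Γ, θ x (θ y ω) = θ (x * y) ω := fun x y => by rw [hθ.2.1]; rfl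
  refine ⟨M, fun n hn x hx => ?_⟩
  have hn1 : (1:ℝ) ≤ n := by
    have : 1 ≤ n := by omega
    exact_mod_cast this
  have hnpos : 0 < ε * n := by positivity
  have hsm := hM n hn.le
  obtain ⟨j, hj⟩ := hcover x
  have hπx := hπ x j hj
  have hvN : π x ∈ N := by rw [hπx]; exact hj
  have one : ∀ t₁ ∈ T, ∀ t₂ ∈ T, ∀ y₁ ∈ T, ∀ y₂ ∈ T,
      c (π x * t₁) (θ y₁ ω) < c (π x * t₂) (θ y₂ ω) + ε * n := by
    intro t₁ ht₁ t₂ ht₂ y₁ hy₁ y₂ hy₂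
    set v := π x with hv
    set a := v * (t₁ * y₁ * y₂⁻¹ * t₂⁻¹) * v⁻¹ with ha
    have haT : a ∈ T := hTnormal _ (T.mul_mem (T.mul_mem (T.mul_mem ht₁ hy₁) (T.inv_mem hy₂))
      (T.inv_mem ht₂)) v hvN
    have e1 : v * t₁ = a * (v * t₂ * (y₂ * y₁⁻¹)) := by rw [ha]; group
    have s1 := h2 a (v * t₂ * (y₂ * y₁⁻¹)) y₁
    have s2 := h2 (v * t₂) (y₂ * y₁⁻¹) y₁
    rw [← e1, hcomp] at s1
    rw [hcomp] at s2
    have e2 : y₂ * y₁⁻¹ * y₁ = y₂ := by group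
    have e3 : v * t₂ * (y₂ * y₁⁻¹) * y₁ = v * t₂ * y₂ := by group
    rw [e2] at s2
    rw [e3] at s1
    have hb := hK j t₂ ht₂ y₂ hy₂
    have hb1 := hK j t₂ ht₂ y₁ hy₁
    have l1 : (wordLength S y₁ : ℝ) < (r + K + 1) * n := by
      have : (wordLength S y₁ : ℝ) ≤ K := by exact_mod_cast (by omega : wordLength S y₁ ≤ K)
      have hK0 : (0:ℝ) ≤ K := Nat.cast_nonneg K
      nlinarith [mul_le_mul_of_nonneg_left hn1 hK0, mul_pos hr (by linarith : (0:ℝ) < n)]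
    have l2 : (wordLength S (v * t₂ * y₂) : ℝ) < (r + K + 1) * n := by
      have q1 := wl_mul S hSsym hSgen (v * t₂) y₂
      have q2 := wl_mul S hSsym hSgen v t₂
      have q3 := wl_mul S hSsym hSgen (z j)⁻¹ x
      rw [← hπx] at q3
      have q : wordLength S (v * t₂ * y₂) ≤ K + wordLength S x := by omega
      have q' : (wordLength S (v * t₂ * y₂) : ℝ) ≤ K + wordLength S x := by exact_mod_cast q
      have hK0 : (0:ℝ) ≤ K := Nat.cast_nonneg K
      nlinarith [mul_le_mul_of_nonneg_left hn1 hK0]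
    have b1 := hsm _ l1 (y₂ * y₁⁻¹) (T.mul_mem hy₂ (T.inv_mem hy₁))
    have b2 := hsm _ l2 a haT
    linarith
  rintro x₁ ⟨t₁, ht₁, rfl⟩ x₂ ⟨t₂, ht₂, rfl⟩ y₁ hy₁ y₂ hy₂
  rw [abs_sub_lt_iff]
  have a1 := one t₁ ht₁ t₂ ht₂ y₁ hy₁ y₂ hy₂
  have a2 := one t₂ ht₂ t₁ ht₁ y₂ hy₂ y₁ hy₁
  constructor <;> linarith
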